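/- Let ν = Σ_{i=1}^N μᵢ δ_{wᵢ} be a discrete probability measure on ℝ^m with zero barycentre, and let ν^∞ = Σ_{j=1}^M τⱼ δ_{wⱼ^∞} be a discrete probability measure on the unit sphere of ℝ^m, and α ≥ 0. Define for m_0 ∈ ℕ the probability measure ν^{m_0} := (1 − 1/m_0) ν + (1/m_0) Σⱼ τⱼ δ_{√(α m_0) wⱼ^∞}. Then for every continuous f : ℝ^m → ℝ possessing an L²-recession function f^∞ (i.e. f(s z')/s² → f^∞(z) as z'→z, s→∞, uniformly on the sphere), one has ⟨ν^{m_0}, f⟩ → ⟨ν, f⟩ + α ⟨ν^∞, f^∞⟩ as m_0 → ∞. -/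

import Mathlib

open Filter Topology

theorem stmt_12 {m : ℕ} (N M : ℕ)
    (μ : Fin N → ℝ) (hμ : ∀ i, 0 ≤ μ i) (hμsum : ∑ i, μ i = 1)
    (w : Fin N → EuclideanSpace ℝ (Fin m)) (hbary : ∑ i, μ i • w i = 0)
    (τ : Fin M → ℝ) (hτ : ∀ j, 0 ≤ τ j) (hτsum : ∑ j, τ j = 1)
    (winf : Fin M → EuclideanSpace ℝ (Fin m)) (hwinf : ∀ j, ‖winf j‖ = 1)
    (α : ℝ) (hα : 0 ≤ α)
    (f : EuclideanSpace ℝ (Fin m) → ℝ) (hf : Continuous f)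
    (finf : EuclideanSpace ℝ (Fin m) → ℝ) (hfinf : Continuous finf)
    (hrec : ∀ ε > (0:ℝ), ∃ S δ : ℝ, 0 < δ ∧ ∀ z : EuclideanSpace ℝ (Fin m), ‖z‖ = 1 →
      ∀ z' : EuclideanSpace ℝ (Fin m), ‖z' - z‖ < δ → ∀ s : ℝ, S ≤ s →
        |f (s • z') / s ^ 2 - finf z| < ε) :
    Tendsto (fun m₀ : ℕ =>
        (1 - 1 / (m₀ : ℝ)) * ∑ i, μ i * f (w i)
          + (1 / (m₀ : ℝ)) * ∑ j, τ j * f (Real.sqrt (α * m₀) • winf j))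
      atTop (𝓝 (∑ i, μ i * f (w i) + α * ∑ j, τ j * finf (winf j))) := by
  have h1 : Tendsto (fun m₀ : ℕ => 1 / (m₀ : ℝ)) atTop (𝓝 0) :=
    tendsto_one_div_atTop_nhds_zero_nat
  have key : ∀ j, Tendsto (fun m₀ : ℕ => (1 / (m₀ : ℝ)) * f (Real.sqrt (α * m₀) • winf j))
      atTop (𝓝 (α * finf (winf j))) := by
    intro j
    rcases hα.eq_or_lt with h0 | hpos
    · subst h0
      simpa using h1.mul_const (f 0)
    · have hs : Tendsto (fun m₀ : ℕ => Real.sqrt (α * m₀)) atTop atTop :=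
        Real.tendsto_sqrt_atTop.comp (tendsto_natCast_atTop_atTop.const_mul_atTop hpos)
      have hr : Tendsto (fun s : ℝ => f (s • winf j) / s ^ 2) atTop (𝓝 (finf (winf j))) := by
        rw [Metric.tendsto_nhds]
        intro ε hε
        obtain ⟨S, δ, hδ, h⟩ := hrec ε hε
        filter_upwards [eventually_ge_atTop S] with s hS
        rw [Real.dist_eq]
        exact h _ (hwinf j) _ (by simpa using hδ) s hS
      refine ((hr.comp hs).const_mul α).congr' ?_
      filter_upwards [eventually_gt_atTop 0] with n hn
      have hn' : (0 : ℝ) < n := by exact_mod_cast hn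
      simp only [Function.comp]
      rw [Real.sq_sqrt (by positivity)]
      field_simp
  have hsum := tendsto_finsetSum Finset.univ (fun j _ => (key j).const_mul (τ j))
  have hfirst := (h1.const_sub 1).mul_const (∑ i, μ i * f (w i))
  have := hfirst.add hsum
  rw [sub_zero, one_mul] at this
  convert this using 2
  · congr 1
    rw [Finset.mul_sum]
    exact Finset.sum_congr rfl fun j _ => by ring
  · congr 1
    rw [Finset.mul_sum]
    exact Finset.sum_congr rfl fun j _ => by ring
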